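/- Let U = {(a1,a2,a3) ∈ (0,1/2)×(0,1/2)×(0,1/2) : Q(a1,a2,a3) ≠ 0} and let O2 be the connected component of U containing the point (7/15, 7/15, 7/15). Then for every (a1,a2,a3) ∈ O2, the set of pairs (x1,x2) of positive reals such that (x1, x2, 1) satisfies system (S) has exactly four elements; exactly one of these four pairs satisfies F2(x1,x2,1) > 0 (a node of the reduced planar Ricci flow system) and the other three satisfy F2(x1,x2,1) < 0 (saddles). -/

import Mathlib

noncomputable section
open Real Set

/-- First equation of system (S). -/
def eqS1 (a1 a2 a3 x1 x2 x3 : ℝ) : Prop :=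
  (a2 + a3)*(a1*x2^2 + a1*x3^2 - x2*x3) + (a2*x2 + a3*x3)*x1
    - (a1*a2 + a1*a3 + 2*a2*a3)*x1^2 = 0

/-- Second equation of system (S). -/
def eqS2 (a1 a2 a3 x1 x2 x3 : ℝ) : Prop :=
  (a1 + a3)*(a2*x1^2 + a2*x3^2 - x1*x3) + (a1*x1 + a3*x3)*x2
    - (a1*a2 + 2*a1*a3 + a2*a3)*x2^2 = 0

/-- The quantity `F2` (determinant numerator). -/
def F2 (a1 a2 a3 x1 x2 x3 : ℝ) : ℝ :=
  let A := a1*a2 + a1*a3 + a2*a3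
  (a1^2*a2*a3*(2*A + a2*a3) - A^3)*x1^4 + (a1*a2^2*a3*(2*A + a1*a3) - A^3)*x2^4
  + (a1*a2*a3^2*(2*A + a1*a2) - A^3)*x3^4
  - 2*a1^2*(A + a2*a3)*(a2*x2 + a3*x3)*x1^3
  - 2*a2^2*(A + a1*a3)*(a1*x1 + a3*x3)*x2^3
  - 2*a3^2*(A + a1*a2)*(a2*x2 + a1*x1)*x3^3
  + (a1*a2*(2*(3*a1*a2 + a2^2 + a1^2)*a3^2 + 2*(a1 + a2)*a1*a2*a3 + a1*a2) + 2*A^3)*x1^2*x2^2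
  + (a1*a3*(2*(3*a1*a3 + a3^2 + a1^2)*a2^2 + 2*(a1 + a3)*a1*a2*a3 + a1*a3) + 2*A^3)*x1^2*x3^2
  + (a2*a3*(2*(3*a2*a3 + a3^2 + a2^2)*a1^2 + 2*(a2 + a3)*a1*a2*a3 + a2*a3) + 2*A^3)*x2^2*x3^2
  - 2*a1*a2*a3*((A + a2*a3 - a1)*x1 + (A + a1*a3 - a2)*x2 + (A + a1*a2 - a3)*x3)*x1*x2*x3

/-- The degeneration polynomial `Q`. -/
def Qpoly (a1 a2 a3 : ℝ) : ℝ :=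
  let s1 := a1 + a2 + a3
  let s2 := a1*a2 + a1*a3 + a2*a3
  let s3 := a1*a2*a3
  (2*s1 + 4*s3 - 1)*(64*s1^5 - 64*s1^4 + 8*s1^3 + 12*s1^2 - 6*s1 + 1
      + 240*s3*s1^2 - 240*s3*s1 - 1536*s3^2*s1 - 4096*s3^3 + 60*s3 + 768*s3^2)
  - 8*s1*(2*s1 + 4*s3 - 1)*(2*s1 - 32*s3 - 1)*(10*s1 + 32*s3 - 5)*s2
  - 16*s1^2*(13 - 52*s1 + 640*s3*s1 + 1024*s3^2 - 320*s3 + 52*s1^2)*s2^2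
  + 64*(2*s1 - 1)*(2*s1 - 32*s3 - 1)*s2^3 + 2048*s1*(2*s1 - 1)*s2^4

/-- The parameter set `U` of non-degenerate parameter triples in the open cube. -/
def Uset : Set (ℝ × ℝ × ℝ) :=
  {p | p.1 ∈ Ioo (0:ℝ) (1/2) ∧ p.2.1 ∈ Ioo (0:ℝ) (1/2) ∧ p.2.2 ∈ Ioo (0:ℝ) (1/2) ∧
    Qpoly p.1 p.2.1 p.2.2 ≠ 0}

open Filter Topology

/-- Difference of the first and third Einstein expressions (with `x3 = 1`). -/
def fE (a1 a2 a3 x y : ℝ) : ℝ :=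
  (y + a1*(x^2 - y^2 - 1)) - (x*y + a3*(1 - x^2 - y^2))

/-- Difference of the second and third Einstein expressions (with `x3 = 1`). -/
def gE (a1 a2 a3 x y : ℝ) : ℝ :=
  (x + a2*(y^2 - x^2 - 1)) - (x*y + a3*(1 - x^2 - y^2))

/-- The Jacobian determinant of `(fE, gE)` in `(x, y)`. -/
def JE (a1 a2 a3 x y : ℝ) : ℝ :=
  (2*a1*x - y + 2*a3*x)*(2*a2*y - x + 2*a3*y)
    - (1 - 2*a1*y - x + 2*a3*y)*(1 - 2*a2*x - y + 2*a3*x)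

lemma sys_iff (a1 a2 a3 x y : ℝ) (h1 : 0 < a1) (h2 : 0 < a2) (h3 : 0 < a3) :
    (eqS1 a1 a2 a3 x y 1 ∧ eqS2 a1 a2 a3 x y 1) ↔
      (fE a1 a2 a3 x y = 0 ∧ gE a1 a2 a3 x y = 0) := by
  unfold eqS1 eqS2 fE gE
  have hA : (a1*a2 + a1*a3 + a2*a3) ≠ 0 := by positivity
  constructor
  · rintro ⟨e1, e2⟩
    constructor
    · apply mul_left_cancel₀ hA
      linear_combination (-(a1 + a3)) * e1 - a3 * e2
    · apply mul_left_cancel₀ hA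
      linear_combination (-a3) * e1 - (a2 + a3) * e2
  · rintro ⟨e1, e2⟩
    constructor
    · linear_combination (-(a2 + a3)) * e1 + a3 * e2
    · linear_combination a3 * e1 - (a1 + a3) * e2

lemma F2_eq (a1 a2 a3 x y : ℝ) (hf : fE a1 a2 a3 x y = 0) (hg : gE a1 a2 a3 x y = 0) :
    F2 a1 a2 a3 x y 1 = (a1*a2 + a1*a3 + a2*a3)^2 * (x*y) * JE a1 a2 a3 x y := by
  unfold fE at hf
  unfold gE at hg
  unfold F2 JE
  linear_combination
    (a3^5-a2^2*a3^3 + a2^3*a3^2-a1*a3^4 + (2)*a1*a2*a3^3 + (4)*a1*a2^2*a3^2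
      + (2)*a1*a2^3*a3 + (3)*a1^2*a3^3 + (7)*a1^2*a2*a3^2 + (5)*a1^2*a2^2*a3 + a1^2*a2^3
      + a2^2*a3^2*y-a3^5*y^2-a2^2*a3^3*y^2 - (3)*a2^3*a3^2*y^2 + a1*a3^4*y^2
      - (4)*a1*a2*a3^3*y^2 - (10)*a1*a2^2*a3^2*y^2 - (4)*a1*a2^3*a3*y^2 - (3)*a1^2*a3^3*y^2
      - (7)*a1^2*a2*a3^2*y^2 - (5)*a1^2*a2^2*a3*y^2-a1^2*a2^3*y^2-a3^4*x + a2*a3^3*x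
      + a1*a3^3*x-a1*a2*a3^2*x - (2)*a1^2*a3^2*x - (2)*a1^2*a2*a3*x + a3^4*x*y-a2*a3^3*x*y
      + a2^2*a3^2*x*y-a1*a3^3*x*y + (3)*a1*a2*a3^2*x*y + (2)*a1*a2^2*a3*x*y
      + (2)*a1^2*a3^2*x*y + (2)*a1^2*a2*a3*x*y-a3^5*x^2
      + (2)*a2*a3^4*x^2-a2^2*a3^3*x^2-a2^3*a3^2*x^2 + a1*a3^4*x^2 - (2)*a1*a2*a3^3*x^2
      - (2)*a1*a2^2*a3^2*x^2
      - (2)*a1*a2^3*a3*x^2-a1^2*a3^3*x^2-a1^2*a2*a3^2*x^2-a1^2*a2^2*a3*x^2-a1^2*a2^3*x^2) * hf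
    + (-a3^5 + a2*a3^4 - (2)*a1*a2*a3^3 - (2)*a1^2*a3^3 - (6)*a1^2*a2*a3^2 - (2)*a1^3*a3^2
      - (2)*a1^3*a2*a3 + a3^4*y-a2*a3^3*y + a2^2*a3^2*y-a1*a3^3*y + (5)*a1*a2*a3^2*y
      + (2)*a1*a2^2*a3*y + (3)*a1^2*a3^2*y + (4)*a1^2*a2*a3*y + a1^2*a2^2*y
      + a3^5*y^2-a2*a3^4*y^2 + (2)*a2^2*a3^3*y^2 - (2)*a1*a3^4*y^2 + (6)*a1*a2*a3^3*y^2
      + (4)*a1^2*a3^3*y^2 - (4)*a1^2*a2*a3^2*y^2 - (4)*a1^2*a2^2*a3*y^2 - (4)*a1^3*a3^2*y^2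
      - (6)*a1^3*a2*a3*y^2 - (2)*a1^3*a2^2*y^2 + a1^2*a3^2*x-a3^4*x*y
      + a2*a3^3*x*y-a2^2*a3^2*x*y + a1*a3^3*x*y - (3)*a1*a2*a3^2*x*y - (2)*a1*a2^2*a3*x*y
      - (2)*a1^2*a3^2*x*y - (2)*a1^2*a2*a3*x*y-a1^2*a2^2*x*y + a3^5*x^2-a2*a3^4*x^2) * hg

/-- A binary cubic form with a double root has vanishing discriminant. -/
lemma disc_zero (b3 b2 b1 b0 s t : ℝ) (hst : s ≠ 0 ∨ t ≠ 0)
    (h1 : 3*b3*s^2 + 2*b2*s*t + b1*t^2 = 0) (h2 : b2*s^2 + 2*b1*s*t + 3*b0*t^2 = 0) :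
    b2^2*b1^2 - 4*b3*b1^3 - 4*b2^3*b0 - 27*b3^2*b0^2 + 18*b3*b2*b1*b0 = 0 := by
  rcases hst with hs | ht
  · have : s^3 ≠ 0 := pow_ne_zero _ hs
    apply mul_left_cancel₀ this
    have key : (-3*s^3) * (b2^2*b1^2 - 4*b3*b1^3 - 4*b2^3*b0 - 27*b3^2*b0^2 + 18*b3*b2*b1*b0) = 0 := by
      linear_combination
        (b1*(6*b2*b0-2*b1^2)*t + (2*b2*(6*b2*b0-2*b1^2) + b1*(b2*b1-9*b3*b0))*s) * h2
        + ((-3*b0)*(6*b2*b0-2*b1^2)*t + (-3*b0*(b2*b1-9*b3*b0) - 2*b1*(6*b2*b0-2*b1^2))*s) * h1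
    linarith
  · have : t^3 ≠ 0 := pow_ne_zero _ ht
    apply mul_left_cancel₀ this
    have key : (-3*t^3) * (b2^2*b1^2 - 4*b3*b1^3 - 4*b2^3*b0 - 27*b3^2*b0^2 + 18*b3*b2*b1*b0) = 0 := by
      linear_combination
        (b2*(6*b1*b3-2*b2^2)*s + (2*b1*(6*b1*b3-2*b2^2) + b2*(b1*b2-9*b0*b3))*t) * h1
        + ((-3*b3)*(6*b1*b3-2*b2^2)*s + (-3*b3*(b1*b2-9*b0*b3) - 2*b2*(6*b1*b3-2*b2^2))*t) * h2
    linarith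

lemma exists_ker (p q r w : ℝ) (h : p*w - q*r = 0) :
    ∃ s t : ℝ, (s ≠ 0 ∨ t ≠ 0) ∧ s*p + t*r = 0 ∧ s*q + t*w = 0 := by
  by_cases hr : r = 0 ∧ p = 0
  · by_cases hw : w = 0 ∧ q = 0
    · exact ⟨1, 0, Or.inl one_ne_zero, by rw [hr.2]; ring, by rw [hw.2]; ring⟩
    · refine ⟨w, -q, ?_, by rw [hr.1, hr.2]; ring, by ring⟩
      by_contra hc
      push Not at hc
      exact hw ⟨hc.1, by linarith [hc.2]⟩
  · refine ⟨r, -p, ?_, by ring, by linarith⟩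
    by_contra hc
    push Not at hc
    exact hr ⟨hc.1, by linarith [hc.2]⟩

lemma Q_disc (a1 a2 a3 b3 b2 b1 b0 : ℝ)
    (e3 : b3 = 8*(a1^3 + a1^2*a3 - a1*a3^2 - a3^3))
    (e2 : b2 = -8*a1^2*a2 + 8*a1^2*a3 - 16*a1*a2*a3 - 8*a2*a3^2 - 24*a3^3 - 16*a1*a3^2 - 2
      + 4*a3 + 4*a2 + 4*a1)
    (e1 : b1 = -8*a1*a2^2 - 16*a1*a2*a3 - 16*a2*a3^2 - 24*a3^3 - 8*a1*a3^2 + 8*a2^2*a3 - 2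
      + 4*a3 + 4*a1 + 4*a2)
    (e0 : b0 = 8*(a2^3 + a2^2*a3 - a2*a3^2 - a3^3))
    (h : b2^2*b1^2 - 4*b3*b1^3 - 4*b2^3*b0 - 27*b3^2*b0^2 + 18*b3*b2*b1*b0 = 0) :
    Qpoly a1 a2 a3 = 0 := by
  subst e3 e2 e1 e0
  unfold Qpoly
  linear_combination (-1/16) * h

/-- A degenerate solution forces `Q = 0`. -/
lemma Q_zero_of_J (a1 a2 a3 x y : ℝ) (hf : fE a1 a2 a3 x y = 0) (hg : gE a1 a2 a3 x y = 0)
    (hJ : JE a1 a2 a3 x y = 0) : Qpoly a1 a2 a3 = 0 := by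
  obtain ⟨s, t, hst, k1, k2⟩ := exists_ker _ _ _ _ hJ
  unfold fE at hf
  unfold gE at hg
  -- entries of the singular Hessian
  obtain ⟨h11, e11⟩ : ∃ h, h = s*(2*a1 + 2*a3) + t*(2*a3 - 2*a2) := ⟨_, rfl⟩
  obtain ⟨h22, e22⟩ : ∃ h, h = s*(2*a3 - 2*a1) + t*(2*a2 + 2*a3) := ⟨_, rfl⟩
  obtain ⟨h33, e33⟩ : ∃ h, h = s*(-2*a1 - 2*a3) + t*(-2*a2 - 2*a3) := ⟨_, rfl⟩
  obtain ⟨h12, e12⟩ : ∃ h, h = -s - t := ⟨_, rfl⟩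
  have r13 : t = -(h11*x + h12*y) := by rw [e11, e12]; linear_combination k1
  have r23 : s = -(h12*x + h22*y) := by rw [e12, e22]; linear_combination k2
  have r33 : h33 = -(t*x + s*y) := by
    rw [e33]; linear_combination 2*s*hf + 2*t*hg - x*k1 - y*k2
  have A11 : h22*h33 - s^2 = (h11*h22 - h12^2)*x^2 := by rw [r33, r13, r23]; ring
  have A22 : h11*h33 - t^2 = (h11*h22 - h12^2)*y^2 := by rw [r33, r13, r23]; ring
  have A12 : t*s - h12*h33 = (h11*h22 - h12^2)*(x*y) := by rw [r33, r13, r23]; ring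
  have A13 : h12*s - h22*t = (h11*h22 - h12^2)*x := by rw [r13, r23]; ring
  have A23 : h12*t - h11*s = (h11*h22 - h12^2)*y := by rw [r13, r23]; ring
  obtain ⟨c, ec⟩ : ∃ c, c = h11*h22 - h12^2 := ⟨_, rfl⟩
  rw [← ec] at A11 A22 A12 A13 A23
  have Ds : (h22*h33 - s^2)*(2*a1 + 2*a3) + (h11*h33 - t^2)*(2*a3 - 2*a1)
      + (h11*h22 - h12^2)*(-2*a1 - 2*a3) + 2*(t*s - h12*h33)*(-1)
      + 2*(h12*t - h11*s) = 0 := by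
    rw [A11, A22, A12, A23, ← ec]
    linear_combination 2*c*hf
  have Dt : (h22*h33 - s^2)*(2*a3 - 2*a2) + (h11*h33 - t^2)*(2*a2 + 2*a3)
      + (h11*h22 - h12^2)*(-2*a2 - 2*a3) + 2*(t*s - h12*h33)*(-1)
      + 2*(h12*s - h22*t) = 0 := by
    rw [A11, A22, A12, A13, ← ec]
    linear_combination 2*c*hg
  rw [e11, e22, e33, e12] at Ds Dt
  refine Q_disc a1 a2 a3 _ _ _ _ rfl rfl rfl rfl (disc_zero _ _ _ _ s t hst ?_ ?_)
  · linear_combination Ds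
  · linear_combination Dt

/-- The number of points in a proper, locally homeomorphic family is locally constant. -/
lemma card_loc {X Y : Type*} [TopologicalSpace X] [TopologicalSpace Y] [T2Space Y] [Nonempty Y]
    (U : Set X) (Z : X → Set Y) (p0 : X) (hp0 : p0 ∈ U) (K : Set Y) (hK : IsCompact K)
    (hsub : ∀ᶠ p in 𝓝[U] p0, Z p ⊆ K)
    (hclosed : ∀ y ∈ K, y ∉ Z p0 → ∀ᶠ z : X × Y in 𝓝 (p0, y), z.1 ∈ U → z.2 ∉ Z z.1)
    (hloc : ∀ y ∈ Z p0, ∃ g : X → Y, Tendsto g (𝓝 p0) (𝓝 y) ∧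
      (∀ᶠ p in 𝓝[U] p0, g p ∈ Z p) ∧
      ∀ᶠ z : X × Y in 𝓝 (p0, y), z.1 ∈ U → z.2 ∈ Z z.1 → z.2 = g z.1) :
    ∀ᶠ p in 𝓝[U] p0, (Z p).ncard = (Z p0).ncard := by
  classical
  choose! g hg1 hg2 hg3 using hloc
  have hsub0 : Z p0 ⊆ K := hsub.self_of_nhdsWithin hp0
  have hfin : (Z p0).Finite := by
    have hev : ∀ y ∈ K, {y' | y' ∈ Z p0 → y' = y} ∈ 𝓝 y := by
      intro y hy
      have hcont : Tendsto (fun y' : Y => (p0, y')) (𝓝 y) (𝓝 (p0, y)) :=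
        (Continuous.prodMk_right p0).tendsto y
      by_cases hyZ : y ∈ Z p0
      · have h0 : y = g y p0 := (hg3 y hyZ).self_of_nhds hp0 hyZ
        filter_upwards [hcont.eventually (hg3 y hyZ)] with y' h hy'
        rw [h hp0 hy']; exact h0.symm
      · filter_upwards [hcont.eventually (hclosed y hy hyZ)] with y' h hy'
        exact absurd hy' (h hp0)
    obtain ⟨t, -, ht⟩ := hK.elim_nhds_subcover _ hev
    refine t.finite_toSet.subset fun y hy => ?_
    obtain ⟨w, hw, hyw⟩ := Set.mem_iUnion₂.1 (ht (hsub0 hy))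
    rw [hyw hy]; exact hw
  have hcov : ∀ᶠ p in 𝓝 p0, ∀ y' ∈ K, p ∈ U → y' ∈ Z p → ∃ y ∈ Z p0, y' = g y p := by
    apply hK.eventually_forall_of_forall_eventually
    intro y hy
    by_cases hyZ : y ∈ Z p0
    · filter_upwards [hg3 y hyZ] with z hz h1 h2
      exact ⟨y, hyZ, hz h1 h2⟩
    · filter_upwards [hclosed y hy hyZ] with z hz h1 h2
      exact absurd h2 (hz h1)
  have hmem : ∀ᶠ p in 𝓝[U] p0, ∀ y ∈ Z p0, g y p ∈ Z p :=
    (Filter.eventually_all_finite hfin).2 hg2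
  have hinj : ∀ᶠ p in 𝓝 p0, ∀ y ∈ Z p0, ∀ y' ∈ Z p0, y ≠ y' → g y p ≠ g y' p := by
    refine (Filter.eventually_all_finite hfin).2 fun y hy => ?_
    refine (Filter.eventually_all_finite hfin).2 fun y' hy' => ?_
    by_cases hne : y = y'
    · exact Filter.Eventually.of_forall fun _ h => absurd hne h
    · filter_upwards [((hg1 y hy).prodMk_nhds (hg1 y' hy')).eventually
        (isClosed_diagonal.isOpen_compl.mem_nhds (show (y, y') ∈ (diagonal Y)ᶜ from hne))] with p hp _
      exact hp
  filter_upwards [hsub, hmem, nhdsWithin_le_nhds hcov, nhdsWithin_le_nhds hinj,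
    self_mem_nhdsWithin] with p h1 h2 h3 h4 h5
  have himg : Z p = (fun y => g y p) '' Z p0 := by
    ext y'
    constructor
    · intro hy'
      obtain ⟨y, hy, e⟩ := h3 y' (h1 hy') h5 hy'
      exact ⟨y, hy, e.symm⟩
    · rintro ⟨y, hy, rfl⟩
      exact h2 y hy
  rw [himg]
  apply Set.InjOn.ncard_image
  intro y hy y' hy' e
  by_contra hne
  exact h4 y hy y' hy' hne e

/-- The system as a map. -/
def PhiE (z : (ℝ × ℝ × ℝ) × (ℝ × ℝ)) : ℝ × ℝ :=
  (fE z.1.1 z.1.2.1 z.1.2.2 z.2.1 z.2.2, gE z.1.1 z.1.2.1 z.1.2.2 z.2.1 z.2.2)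

lemma PhiE_contDiff : ContDiff ℝ 1 PhiE := by
  unfold PhiE fE gE
  fun_prop

lemma deriv_quad (c l q : ℝ) : HasDerivAt (fun s : ℝ => c + s*l + s^2*q) l 0 := by
  have h := (((hasDerivAt_id (0:ℝ)).mul_const l).const_add c).add
    (((hasDerivAt_id (0:ℝ)).pow 2).mul_const q)
  have h' : HasDerivAt (fun s : ℝ => c + s*l + s^2*q) _ 0 := h
  convert h' using 1
  simp

lemma PhiE_inv (u : (ℝ × ℝ × ℝ) × (ℝ × ℝ))
    (hJ : JE u.1.1 u.1.2.1 u.1.2.2 u.2.1 u.2.2 ≠ 0) :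
    ((fderiv ℝ PhiE u) ∘L ContinuousLinearMap.inr ℝ (ℝ × ℝ × ℝ) (ℝ × ℝ)).IsInvertible := by
  obtain ⟨⟨a1, a2, a3⟩, x, y⟩ := u
  simp only at hJ
  set D := fderiv ℝ PhiE ((a1, a2, a3), (x, y)) with hD
  have hval : ∀ v1 v2 : ℝ, D ((0, 0, 0), (v1, v2)) =
      ((2*a1*x - y + 2*a3*x)*v1 + (1 - 2*a1*y - x + 2*a3*y)*v2,
       (1 - 2*a2*x - y + 2*a3*x)*v1 + (2*a2*y - x + 2*a3*y)*v2) := by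
    intro v1 v2
    have hd : HasFDerivAt PhiE D ((a1, a2, a3), (x, y)) :=
      (PhiE_contDiff.differentiable one_ne_zero _).hasFDerivAt
    have hl : HasDerivAt (fun s : ℝ => (((a1, a2, a3), (x + s*v1, y + s*v2)) :
        (ℝ × ℝ × ℝ) × (ℝ × ℝ))) ((0, 0, 0), (v1, v2)) 0 := by
      have hx : HasDerivAt (fun s : ℝ => x + s*v1) v1 0 := by
        simpa using ((hasDerivAt_id (0:ℝ)).mul_const v1).const_add x
      have hy : HasDerivAt (fun s : ℝ => y + s*v2) v2 0 := by
        simpa using ((hasDerivAt_id (0:ℝ)).mul_const v2).const_add y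
      exact (hasDerivAt_const (0:ℝ) ((a1, a2, a3) : ℝ × ℝ × ℝ)).prodMk (hx.prodMk hy)
    have hd' : HasFDerivAt PhiE D ((a1, a2, a3), (x + 0*v1, y + 0*v2)) := by simpa using hd
    have h1 : HasDerivAt (fun s : ℝ => PhiE ((a1, a2, a3), (x + s*v1, y + s*v2)))
        (D ((0, 0, 0), (v1, v2))) 0 := by
      have h0 := HasFDerivAt.comp_hasDerivAt (l := PhiE) (l' := D) (0:ℝ) hd' hl
      exact h0
    have h2 : HasDerivAt (fun s : ℝ => PhiE ((a1, a2, a3), (x + s*v1, y + s*v2)))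
      ((2*a1*x - y + 2*a3*x)*v1 + (1 - 2*a1*y - x + 2*a3*y)*v2,
       (1 - 2*a2*x - y + 2*a3*x)*v1 + (2*a2*y - x + 2*a3*y)*v2) 0 := by
      have hf := deriv_quad (fE a1 a2 a3 x y)
        ((2*a1*x - y + 2*a3*x)*v1 + (1 - 2*a1*y - x + 2*a3*y)*v2)
        (a1*(v1^2 - v2^2) - v1*v2 + a3*(v1^2 + v2^2))
      have hg := deriv_quad (gE a1 a2 a3 x y)
        ((1 - 2*a2*x - y + 2*a3*x)*v1 + (2*a2*y - x + 2*a3*y)*v2)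
        (a2*(v2^2 - v1^2) - v1*v2 + a3*(v1^2 + v2^2))
      convert hf.prodMk hg using 1
      funext s
      simp only [PhiE, fE, gE, Prod.mk.injEq]
      constructor <;> ring
    exact h1.unique h2
  have hinj : Function.Injective
      (D ∘L ContinuousLinearMap.inr ℝ (ℝ × ℝ × ℝ) (ℝ × ℝ)) := by
    rw [injective_iff_map_eq_zero]
    rintro ⟨v1, v2⟩ hv
    have hv' : D ((0, 0, 0), (v1, v2)) = 0 := hv
    rw [hval] at hv'
    have q1 := congrArg Prod.fst hv'
    have q2 := congrArg Prod.snd hv'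
    simp only [Prod.fst_zero, Prod.snd_zero] at q1 q2
    unfold JE at hJ
    have z1 : v1 = 0 := by
      apply mul_left_cancel₀ hJ
      linear_combination (2*a2*y - x + 2*a3*y)*q1 - (1 - 2*a1*y - x + 2*a3*y)*q2
    have z2 : v2 = 0 := by
      apply mul_left_cancel₀ hJ
      linear_combination (2*a1*x - y + 2*a3*x)*q2 - (1 - 2*a2*x - y + 2*a3*x)*q1
    rw [z1, z2]; rfl
  let e := LinearEquiv.ofInjectiveEndo
    ((D ∘L ContinuousLinearMap.inr ℝ (ℝ × ℝ × ℝ) (ℝ × ℝ)) : (ℝ × ℝ) →ₗ[ℝ] (ℝ × ℝ)) hinj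
  refine ⟨e.toContinuousLinearEquiv, ?_⟩
  ext <;> rfl

/-- Homogeneous versions of the two equations. -/
def fH (a1 a2 a3 x y z : ℝ) : ℝ :=
  (y*z + a1*(x^2 - y^2 - z^2)) - (x*y + a3*(z^2 - x^2 - y^2))

def gH (a1 a2 a3 x y z : ℝ) : ℝ :=
  (x*z + a2*(y^2 - x^2 - z^2)) - (x*y + a3*(z^2 - x^2 - y^2))

lemma bdry (a b c u v : ℝ) (ha : 0 < a) (hb : 0 < b) (hc : c < 1/2) (hu : 0 ≤ u) (hv : 0 ≤ v)
    (h1 : a*(u^2 - v^2) = u*v - c*(u^2 + v^2)) (h2 : b*(v^2 - u^2) = u*v - c*(u^2 + v^2)) :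
    u = 0 ∧ v = 0 := by
  have h3 : (a + b)*(u + v)*(u - v) = 0 := by linear_combination h1 - h2
  have huv : u = v := by
    rcases mul_eq_zero.1 h3 with h | h
    · rcases mul_eq_zero.1 h with h | h
      · linarith
      · linarith
    · linarith
  subst huv
  have h4 : (1 - 2*c)*u^2 = 0 := by linear_combination -h1
  have h5 : u^2 = 0 := by
    rcases mul_eq_zero.1 h4 with h | h
    · linarith
    · exact h
  have : u = 0 := by simpa using h5
  exact ⟨this, this⟩

lemma hom_pos (a1 a2 a3 x y z : ℝ) (h1 : 0 < a1) (h2 : 0 < a2) (h3 : 0 < a3)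
    (h1' : a1 < 1/2) (h2' : a2 < 1/2) (h3' : a3 < 1/2)
    (hx : 0 ≤ x) (hy : 0 ≤ y) (hz : 0 ≤ z) (hs : x + y + z = 1)
    (hf : fH a1 a2 a3 x y z = 0) (hg : gH a1 a2 a3 x y z = 0) : 0 < x ∧ 0 < y ∧ 0 < z := by
  unfold fH at hf
  unfold gH at hg
  refine ⟨lt_of_le_of_ne hx ?_, lt_of_le_of_ne hy ?_, lt_of_le_of_ne hz ?_⟩
  · rintro rfl
    obtain ⟨p, q⟩ := bdry a2 a3 a1 y z h2 h3 h1' hy hz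
      (by linear_combination hg - hf) (by linear_combination -hf)
    linarith
  · rintro rfl
    obtain ⟨p, q⟩ := bdry a1 a3 a2 x z h1 h3 h2' hx hz
      (by linear_combination hf - hg) (by linear_combination -hg)
    linarith
  · rintro rfl
    obtain ⟨p, q⟩ := bdry a1 a2 a3 x y h1 h2 h3' hx hy
      (by linear_combination hf) (by linear_combination hg)
    linarith

/-- The open parameter cube. -/
def inCube (p : ℝ × ℝ × ℝ) : Prop :=
  p.1 ∈ Ioo (0:ℝ) (1/2) ∧ p.2.1 ∈ Ioo (0:ℝ) (1/2) ∧ p.2.2 ∈ Ioo (0:ℝ) (1/2)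

/-- Positive solutions stay in a fixed compact box when the parameters vary locally. -/
lemma proper_loc (p0 : ℝ × ℝ × ℝ) (hp : inCube p0) :
    ∃ e : ℝ, 0 < e ∧ ∀ᶠ p in 𝓝 p0, ∀ x y : ℝ, 0 < x → 0 < y →
      fE p.1 p.2.1 p.2.2 x y = 0 → gE p.1 p.2.1 p.2.2 x y = 0 →
      (x, y) ∈ Icc e (1/e) ×ˢ Icc e (1/e) := by
  obtain ⟨⟨hp1, hp1'⟩, ⟨hp2, hp2'⟩, hp3, hp3'⟩ := hp
  let K : Set (ℝ × ℝ × ℝ) :=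
    (Icc (0:ℝ) 1 ×ˢ Icc (0:ℝ) 1 ×ˢ Icc (0:ℝ) 1) ∩ {w | w.1 + w.2.1 + w.2.2 = 1}
  have hK : IsCompact K := by
    apply (isCompact_Icc.prod (isCompact_Icc.prod isCompact_Icc)).inter_right
    exact isClosed_eq (by fun_prop) (by fun_prop)
  have main : ∀ᶠ q : (ℝ × ℝ × ℝ) × ℝ in 𝓝 (p0, (0:ℝ)), ∀ w ∈ K,
      fH q.1.1 q.1.2.1 q.1.2.2 w.1 w.2.1 w.2.2 = 0 →
      gH q.1.1 q.1.2.1 q.1.2.2 w.1 w.2.1 w.2.2 = 0 →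
      q.2 < w.1 ∧ q.2 < w.2.1 ∧ q.2 < w.2.2 := by
    apply hK.eventually_forall_of_forall_eventually
    rintro ⟨x, y, z⟩ ⟨⟨hx, hy, hz⟩, hs⟩
    have cf : Continuous fun r : ((ℝ × ℝ × ℝ) × ℝ) × (ℝ × ℝ × ℝ) =>
        fH r.1.1.1 r.1.1.2.1 r.1.1.2.2 r.2.1 r.2.2.1 r.2.2.2 := by
      unfold fH; fun_prop
    have cg : Continuous fun r : ((ℝ × ℝ × ℝ) × ℝ) × (ℝ × ℝ × ℝ) =>
        gH r.1.1.1 r.1.1.2.1 r.1.1.2.2 r.2.1 r.2.2.1 r.2.2.2 := by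
      unfold gH; fun_prop
    by_cases hf : fH p0.1 p0.2.1 p0.2.2 x y z = 0
    · by_cases hg : gH p0.1 p0.2.1 p0.2.2 x y z = 0
      · obtain ⟨q1, q2, q3⟩ := hom_pos _ _ _ x y z hp1 hp2 hp3 hp1' hp2' hp3' hx.1 hy.1 hz.1 hs hf hg
        have l1 : ∀ᶠ r : ((ℝ × ℝ × ℝ) × ℝ) × (ℝ × ℝ × ℝ) in 𝓝 ((p0, (0:ℝ)), (x, y, z)),
            r.1.2 < r.2.1 :=
          (isOpen_lt (by fun_prop) (by fun_prop)).mem_nhds q1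
        have l2 : ∀ᶠ r : ((ℝ × ℝ × ℝ) × ℝ) × (ℝ × ℝ × ℝ) in 𝓝 ((p0, (0:ℝ)), (x, y, z)),
            r.1.2 < r.2.2.1 :=
          (isOpen_lt (by fun_prop) (by fun_prop)).mem_nhds q2
        have l3 : ∀ᶠ r : ((ℝ × ℝ × ℝ) × ℝ) × (ℝ × ℝ × ℝ) in 𝓝 ((p0, (0:ℝ)), (x, y, z)),
            r.1.2 < r.2.2.2 :=
          (isOpen_lt (by fun_prop) (by fun_prop)).mem_nhds q3
        filter_upwards [l1, l2, l3] with r m1 m2 m3 _ _ using ⟨m1, m2, m3⟩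
      · filter_upwards [(cg.tendsto ((p0, (0:ℝ)), (x, y, z))).eventually_ne hg] with r hr _ h2
        exact absurd h2 hr
    · filter_upwards [(cf.tendsto ((p0, (0:ℝ)), (x, y, z))).eventually_ne hf] with r hr h1 _
      exact absurd h1 hr
  rw [nhds_prod_eq] at main
  obtain ⟨pa, hpa, pb, hpb, hab⟩ := Filter.eventually_prod_iff.1 main
  have hb' : ∀ᶠ e in 𝓝[>] (0:ℝ), pb e := nhdsWithin_le_nhds hpb
  obtain ⟨e, hbe, he⟩ := (hb'.and self_mem_nhdsWithin).exists
  have he : 0 < e := he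
  refine ⟨e, he, ?_⟩
  filter_upwards [hpa] with p hpp x y hx hy hf hg
  have hS : 0 < x + y + 1 := by positivity
  have hfH : fH p.1 p.2.1 p.2.2 (x/(x+y+1)) (y/(x+y+1)) (1/(x+y+1)) = 0 := by
    have : fH p.1 p.2.1 p.2.2 (x/(x+y+1)) (y/(x+y+1)) (1/(x+y+1))
        = fE p.1 p.2.1 p.2.2 x y / (x+y+1)^2 := by
      unfold fH fE; field_simp
    rw [this, hf, zero_div]
  have hgH : gH p.1 p.2.1 p.2.2 (x/(x+y+1)) (y/(x+y+1)) (1/(x+y+1)) = 0 := by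
    have : gH p.1 p.2.1 p.2.2 (x/(x+y+1)) (y/(x+y+1)) (1/(x+y+1))
        = gE p.1 p.2.1 p.2.2 x y / (x+y+1)^2 := by
      unfold gH gE; field_simp
    rw [this, hg, zero_div]
  have hmem : ((x/(x+y+1)), (y/(x+y+1)), (1/(x+y+1))) ∈ K := by
    refine ⟨⟨⟨by positivity, ?_⟩, ⟨by positivity, ?_⟩, ⟨by positivity, ?_⟩⟩, ?_⟩
    · rw [div_le_one hS]; linarith
    · rw [div_le_one hS]; linarith
    · rw [div_le_one hS]; linarith
    · show x/(x+y+1) + y/(x+y+1) + 1/(x+y+1) = 1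
      field_simp
  obtain ⟨b1, b2, b3⟩ := hab hpp hbe _ hmem hfH hgH
  simp only at b1 b2 b3
  rw [lt_div_iff₀ hS] at b1 b2 b3
  have t1 : e*x < 1 := by nlinarith [mul_pos he hy]
  have t2 : e*y < 1 := by nlinarith [mul_pos he hx]
  refine ⟨⟨?_, ?_⟩, ⟨?_, ?_⟩⟩
  · show e ≤ x
    nlinarith [mul_pos he hy, mul_pos he hx]
  · show x ≤ 1/e
    rw [le_div_iff₀ he]; linarith
  · show e ≤ y
    nlinarith [mul_pos he hy, mul_pos he hx]
  · show y ≤ 1/e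
    rw [le_div_iff₀ he]; linarith

/-- Positive solutions with a sign condition on `F2`. -/
def Zset (φ : ℝ → ℝ) (p : ℝ × ℝ × ℝ) : Set (ℝ × ℝ) :=
  {w | 0 < w.1 ∧ 0 < w.2 ∧ PhiE (p, w) = 0 ∧ 0 < φ (F2 p.1 p.2.1 p.2.2 w.1 w.2 1)}

lemma F2_ne (p : ℝ × ℝ × ℝ) (hp : p ∈ Uset) (w : ℝ × ℝ) (h1 : 0 < w.1) (h2 : 0 < w.2)
    (h : PhiE (p, w) = 0) :
    F2 p.1 p.2.1 p.2.2 w.1 w.2 1 ≠ 0 ∧ JE p.1 p.2.1 p.2.2 w.1 w.2 ≠ 0 := by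
  obtain ⟨⟨hp1, _⟩, ⟨hp2, _⟩, ⟨hp3, _⟩, hQ⟩ := hp
  have hf : fE p.1 p.2.1 p.2.2 w.1 w.2 = 0 := congrArg Prod.fst h
  have hg : gE p.1 p.2.1 p.2.2 w.1 w.2 = 0 := congrArg Prod.snd h
  have hJ : JE p.1 p.2.1 p.2.2 w.1 w.2 ≠ 0 := fun hJ => hQ (Q_zero_of_J _ _ _ _ _ hf hg hJ)
  refine ⟨?_, hJ⟩
  rw [F2_eq _ _ _ _ _ hf hg]
  refine mul_ne_zero ?_ hJ
  positivity

lemma F2_cont : Continuous fun z : (ℝ × ℝ × ℝ) × (ℝ × ℝ) =>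
    F2 z.1.1 z.1.2.1 z.1.2.2 z.2.1 z.2.2 1 := by
  unfold F2
  fun_prop

lemma Z_loc (φ : ℝ → ℝ) (hφ : Continuous φ) (hφ0 : ∀ r, r ≠ 0 → φ r ≠ 0)
    (p0 : ℝ × ℝ × ℝ) (hp0 : p0 ∈ Uset) :
    ∀ᶠ p in 𝓝[Uset] p0, (Zset φ p).ncard = (Zset φ p0).ncard := by
  obtain ⟨e, he, hev⟩ := proper_loc p0 ⟨hp0.1, hp0.2.1, hp0.2.2.1⟩
  have hc : Continuous fun z : (ℝ × ℝ × ℝ) × (ℝ × ℝ) =>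
      φ (F2 z.1.1 z.1.2.1 z.1.2.2 z.2.1 z.2.2 1) := hφ.comp F2_cont
  refine card_loc Uset (Zset φ) p0 hp0 (Icc e (1/e) ×ˢ Icc e (1/e))
    (isCompact_Icc.prod isCompact_Icc) ?_ ?_ ?_
  · filter_upwards [nhdsWithin_le_nhds hev] with p hp
    rintro ⟨x, y⟩ ⟨h1, h2, h3, -⟩
    exact hp x y h1 h2 (congrArg Prod.fst h3) (congrArg Prod.snd h3)
  · intro w hw hwZ
    have w1 : 0 < w.1 := lt_of_lt_of_le he hw.1.1
    have w2 : 0 < w.2 := lt_of_lt_of_le he hw.2.1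
    by_cases hs : PhiE (p0, w) = 0
    · have hne := hφ0 _ (F2_ne p0 hp0 w w1 w2 hs).1
      have hlt : φ (F2 p0.1 p0.2.1 p0.2.2 w.1 w.2 1) < 0 := by
        rcases lt_or_gt_of_ne hne with h | h
        · exact h
        · exact absurd ⟨w1, w2, hs, h⟩ hwZ
      have := (hc.tendsto (p0, w)).eventually_lt_const hlt
      filter_upwards [this] with z hz _ hzZ
      exact absurd hzZ.2.2.2 (not_lt.2 hz.le)
    · filter_upwards [(PhiE_contDiff.continuous.tendsto (p0, w)).eventually_ne hs] with z hz _ hzZ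
      exact hz hzZ.2.2.1
  · rintro w ⟨w1, w2, hs, hpos⟩
    have hJ := (F2_ne p0 hp0 w w1 w2 hs).2
    have hd : HasStrictFDerivAt PhiE (fderiv ℝ PhiE (p0, w)) (p0, w) :=
      PhiE_contDiff.contDiffAt.hasStrictFDerivAt one_ne_zero
    have hi := PhiE_inv (p0, w) hJ
    have ht := hd.tendsto_implicitFunctionOfProdDomain hi
    refine ⟨hd.implicitFunctionOfProdDomain hi, ht, ?_, ?_⟩
    · apply nhdsWithin_le_nhds
      have ht2 : Tendsto (fun p => (p, hd.implicitFunctionOfProdDomain hi p)) (𝓝 p0)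
          (𝓝 (p0, w)) := tendsto_id.prodMk_nhds ht
      have o1 : ∀ᶠ z : (ℝ × ℝ × ℝ) × (ℝ × ℝ) in 𝓝 (p0, w), 0 < z.2.1 :=
        (isOpen_lt (by fun_prop) (by fun_prop)).mem_nhds w1
      have o2 : ∀ᶠ z : (ℝ × ℝ × ℝ) × (ℝ × ℝ) in 𝓝 (p0, w), 0 < z.2.2 :=
        (isOpen_lt (by fun_prop) (by fun_prop)).mem_nhds w2
      have o3 := (hc.tendsto (p0, w)).eventually_const_lt hpos
      filter_upwards [ht2.eventually o1, ht2.eventually o2, ht2.eventually o3,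
        hd.eventually_apply_implicitFunctionOfProdDomain hi] with p m1 m2 m3 m4
      exact ⟨m1, m2, m4.trans hs, m3⟩
    · filter_upwards [hd.eventually_apply_eq_iff_implicitFunctionOfProdDomain hi] with z hz _ hzZ
      exact (hz.1 (hzZ.2.2.1.trans hs.symm)).symm

lemma Z_const (φ : ℝ → ℝ) (hφ : Continuous φ) (hφ0 : ∀ r, r ≠ 0 → φ r ≠ 0)
    (b p : ℝ × ℝ × ℝ) (hp : p ∈ connectedComponentIn Uset b) :
    (Zset φ p).ncard = (Zset φ b).ncard := by
  have hb : b ∈ Uset := by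
    by_contra hb
    rw [connectedComponentIn_eq_empty hb] at hp
    exact hp
  have hcont : ContinuousOn (fun p => (Zset φ p).ncard) (connectedComponentIn Uset b) := by
    intro q hq
    have h := Z_loc φ hφ hφ0 q (connectedComponentIn_subset _ _ hq)
    have h' := nhdsWithin_mono q (connectedComponentIn_subset Uset b) h
    exact (tendsto_const_nhds (x := (Zset φ q).ncard)).congr' (by
      filter_upwards [h'] with r hr using hr.symm)
  exact isPreconnected_connectedComponentIn.constant hcont hp (mem_connectedComponentIn hb)

lemma base_sol (x y : ℝ) (h : PhiE ((7/15, 7/15, 7/15), (x, y)) = 0) :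
    (x = 1 ∧ y = 1) ∨ (x = 14 ∧ y = 14) ∨ (x = 1 ∧ y = 1/14) ∨ (x = 1/14 ∧ y = 1) := by
  have hf : fE (7/15) (7/15) (7/15) x y = 0 := congrArg Prod.fst h
  have hg : gE (7/15) (7/15) (7/15) x y = 0 := congrArg Prod.snd h
  unfold fE at hf
  unfold gE at hg
  have f' : (x - 1) * (14*(x + 1) - 15*y) = 0 := by linear_combination 15*hf
  have g' : (y - 1) * (14*(y + 1) - 15*x) = 0 := by linear_combination 15*hg
  rcases mul_eq_zero.1 f' with h1 | h1 <;> rcases mul_eq_zero.1 g' with h2 | h2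
  · left; constructor <;> linarith
  · right; right; left; constructor <;> linarith
  · right; right; right; constructor <;> linarith
  · right; left; constructor <;> linarith

lemma base_iff (φ : ℝ → ℝ) (w : ℝ × ℝ) :
    w ∈ Zset φ (7/15, 7/15, 7/15) ↔
      ((w = (1, 1) ∧ 0 < φ (405769/1265625)) ∨ (w = (14, 14) ∧ 0 < φ (-2306390996/1265625)) ∨
       (w = (1, 1/14) ∧ 0 < φ (-240149/5062500)) ∨
       (w = (1/14, 1) ∧ 0 < φ (-240149/5062500))) := by
  obtain ⟨x, y⟩ := w
  have v1 : F2 (7/15) (7/15) (7/15) 1 1 1 = 405769/1265625 := by unfold F2; norm_num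
  have v2 : F2 (7/15) (7/15) (7/15) 14 14 1 = -2306390996/1265625 := by unfold F2; norm_num
  have v3 : F2 (7/15) (7/15) (7/15) 1 (1/14) 1 = -240149/5062500 := by unfold F2; norm_num
  have v4 : F2 (7/15) (7/15) (7/15) (1/14) 1 1 = -240149/5062500 := by unfold F2; norm_num
  simp only [Zset, Set.mem_ofPred_eq, Prod.mk.injEq]
  constructor
  · rintro ⟨-, -, h, hp⟩
    rcases base_sol x y h with ⟨rfl, rfl⟩ | ⟨rfl, rfl⟩ | ⟨rfl, rfl⟩ | ⟨rfl, rfl⟩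
    · rw [v1] at hp; exact Or.inl ⟨⟨rfl, rfl⟩, hp⟩
    · rw [v2] at hp; exact Or.inr (Or.inl ⟨⟨rfl, rfl⟩, hp⟩)
    · rw [v3] at hp; exact Or.inr (Or.inr (Or.inl ⟨⟨rfl, rfl⟩, hp⟩))
    · rw [v4] at hp; exact Or.inr (Or.inr (Or.inr ⟨⟨rfl, rfl⟩, hp⟩))
  · rintro (⟨⟨rfl, rfl⟩, hp⟩ | ⟨⟨rfl, rfl⟩, hp⟩ | ⟨⟨rfl, rfl⟩, hp⟩ | ⟨⟨rfl, rfl⟩, hp⟩)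
    · refine ⟨by norm_num, by norm_num, ?_, by rw [v1]; exact hp⟩
      ext <;> norm_num [PhiE, fE, gE]
    · refine ⟨by norm_num, by norm_num, ?_, by rw [v2]; exact hp⟩
      ext <;> norm_num [PhiE, fE, gE]
    · refine ⟨by norm_num, by norm_num, ?_, by rw [v3]; exact hp⟩
      ext <;> norm_num [PhiE, fE, gE]
    · refine ⟨by norm_num, by norm_num, ?_, by rw [v4]; exact hp⟩
      ext <;> norm_num [PhiE, fE, gE]

lemma base_all : (Zset (fun r => r^2) (7/15, 7/15, 7/15)).ncard = 4 := by
  have : Zset (fun r => r^2) (7/15, 7/15, 7/15) =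
      (({(1, 1), (14, 14), (1, 1/14), (1/14, 1)} : Finset (ℝ × ℝ)) : Set (ℝ × ℝ)) := by
    ext w
    rw [base_iff]
    norm_num
  rw [this, Set.ncard_coe_finset]
  rw [Finset.card_insert_of_notMem, Finset.card_insert_of_notMem, Finset.card_insert_of_notMem,
    Finset.card_singleton] <;> norm_num

lemma base_pos : (Zset (fun r => r) (7/15, 7/15, 7/15)).ncard = 1 := by
  have : Zset (fun r => r) (7/15, 7/15, 7/15) = {(1, 1)} := by
    ext w
    rw [base_iff]
    norm_num
  rw [this, Set.ncard_singleton]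

lemma base_neg : (Zset (fun r => -r) (7/15, 7/15, 7/15)).ncard = 3 := by
  have : Zset (fun r => -r) (7/15, 7/15, 7/15) =
      (({(14, 14), (1, 1/14), (1/14, 1)} : Finset (ℝ × ℝ)) : Set (ℝ × ℝ)) := by
    ext w
    rw [base_iff]
    norm_num
  rw [this, Set.ncard_coe_finset]
  rw [Finset.card_insert_of_notMem, Finset.card_insert_of_notMem,
    Finset.card_singleton] <;> norm_num

lemma PhiE_iff (p : ℝ × ℝ × ℝ) (hp : p ∈ Uset) (w : ℝ × ℝ) :
    PhiE (p, w) = 0 ↔ (eqS1 p.1 p.2.1 p.2.2 w.1 w.2 1 ∧ eqS2 p.1 p.2.1 p.2.2 w.1 w.2 1) := by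
  rw [sys_iff _ _ _ _ _ hp.1.1 hp.2.1.1 hp.2.2.1.1]
  simp only [PhiE, Prod.mk_eq_zero]

theorem component_O2_singular_points :
    ∀ p ∈ connectedComponentIn Uset ((7/15 : ℝ), (7/15 : ℝ), (7/15 : ℝ)),
      ({xy : ℝ × ℝ | 0 < xy.1 ∧ 0 < xy.2 ∧ eqS1 p.1 p.2.1 p.2.2 xy.1 xy.2 1 ∧ eqS2 p.1 p.2.1 p.2.2 xy.1 xy.2 1}).ncard = 4 ∧
      ({xy : ℝ × ℝ | 0 < xy.1 ∧ 0 < xy.2 ∧ eqS1 p.1 p.2.1 p.2.2 xy.1 xy.2 1 ∧ eqS2 p.1 p.2.1 p.2.2 xy.1 xy.2 1 ∧ 0 < F2 p.1 p.2.1 p.2.2 xy.1 xy.2 1}).ncard = 1 ∧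
      ({xy : ℝ × ℝ | 0 < xy.1 ∧ 0 < xy.2 ∧ eqS1 p.1 p.2.1 p.2.2 xy.1 xy.2 1 ∧ eqS2 p.1 p.2.1 p.2.2 xy.1 xy.2 1 ∧ F2 p.1 p.2.1 p.2.2 xy.1 xy.2 1 < 0}).ncard = 3 := by
  intro p hp
  have hU : p ∈ Uset := connectedComponentIn_subset _ _ hp
  have c1 := Z_const (fun r => r^2) (by fun_prop) (fun r hr => pow_ne_zero 2 hr) _ p hp
  have c2 := Z_const (fun r => r) (by fun_prop) (fun r hr => hr) _ p hp
  have c3 := Z_const (fun r => -r) (by fun_prop) (fun r hr => neg_ne_zero.2 hr) _ p hp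
  rw [base_all] at c1
  rw [base_pos] at c2
  rw [base_neg] at c3
  refine ⟨?_, ?_, ?_⟩
  · rw [← c1]
    congr 1
    ext w
    simp only [Zset, Set.mem_ofPred_eq, PhiE_iff p hU]
    constructor
    · rintro ⟨h1, h2, h3, h4⟩
      have := (F2_ne p hU w h1 h2 ((PhiE_iff p hU w).2 ⟨h3, h4⟩)).1
      exact ⟨h1, h2, ⟨h3, h4⟩, by positivity⟩
    · rintro ⟨h1, h2, ⟨h3, h4⟩, -⟩
      exact ⟨h1, h2, h3, h4⟩
  · rw [← c2]
    congr 1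
    ext w
    simp only [Zset, Set.mem_ofPred_eq, PhiE_iff p hU, and_assoc]
  · rw [← c3]
    congr 1
    ext w
    simp only [Zset, Set.mem_ofPred_eq, PhiE_iff p hU, and_assoc, Left.neg_pos_iff]
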